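/- arXiv:1203.4990 — 5 statements merged into one kernel-verified Lean document; each statement's English description precedes it below -/
import Mathlib

section
/- There exist three pairwise disjoint open arcs J₁, J₂, J₃ ⊆ ℝ/ℤ, vectors c¹, c², c³ ∈ supp μ, points x_i ∈ J_i (i = 1,2,3), and α₀ > 0 such that for each i the function F̃_i = Σ_{k=1}^K c^i_k F^k attains its maximum over ℝ/ℤ at the unique point x_i, and for every α ∈ (0, α₀] there is an open arc I with x_i ∈ I ⊆ J_i and F̃_i(y) ≤ F̃_i(x_i) − α for every y ∈ ℝ/ℤ ∖ I. -/
open MeasureTheory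

/-- An open arc of the circle `ℝ/ℤ` is the image modulo 1 of an open interval of
length less than 1. -/
def IsOpenArc (J : Set UnitAddCircle) : Prop :=
  ∃ a l : ℝ, l < 1 ∧ J = (fun x : ℝ => (x : UnitAddCircle)) '' Set.Ioo a (a + l)

/-- `c` belongs to the (topological) support of the measure `μ`. -/
def MemSupp {E : Type*} [TopologicalSpace E] [MeasurableSpace E] (μ : Measure E) (c : E) : Prop :=
  ∀ U : Set E, IsOpen U → c ∈ U → 0 < μ U

open Set Filter Topology

/-- The image of an open interval of the line under the projection to the circle is open. -/
theorem UnitAddCircle.isOpen_coe_image_Ioo (a b : ℝ) :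
    IsOpen ((fun x : ℝ => (x : UnitAddCircle)) '' Ioo a b) :=
  QuotientAddGroup.isOpenMap_coe _ isOpen_Ioo

theorem UnitAddCircle.coe_eq_coe_iff_exists_int {x y : ℝ} :
    (x : UnitAddCircle) = y ↔ ∃ m : ℤ, x - y = m := by
  rw [← sub_eq_zero, ← AddCircle.coe_sub, AddCircle.coe_eq_zero_iff]
  simp [eq_comm]

theorem UnitAddCircle.coe_image_Ioo_subset_ball (x r : ℝ) :
    (fun x : ℝ => (x : UnitAddCircle)) '' Ioo (x - r) (x + r) ⊆
      Metric.ball (x : UnitAddCircle) r := by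
  rintro _ ⟨y, hy, rfl⟩
  have h : ‖((y - x : ℝ) : UnitAddCircle)‖ ≤ |y - x| := by
    simpa using QuotientAddGroup.norm_mk_le_norm (S := AddSubgroup.zmultiples (1 : ℝ)) (m := y - x)
  rw [Metric.mem_ball, dist_eq_norm, ← AddCircle.coe_sub]
  exact h.trans_lt (abs_lt.2 ⟨by linarith [hy.1], by linarith [hy.2]⟩)

/-- Distinct points of a finite family are uniformly separated. -/
theorem Function.Injective.exists_pos_le_dist {ι X : Type*} [Finite ι] [MetricSpace X] {p : ι → X}
    (hp : Function.Injective p) :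
    ∃ r : ℝ, 0 < r ∧ r < 1 ∧ ∀ i j, i ≠ j → r ≤ dist (p i) (p j) := by
  have h : ∀ᶠ r : ℝ in 𝓝[>] 0, ∀ i j, i ≠ j → r ≤ dist (p i) (p j) := by
    refine eventually_all.2 fun i => eventually_all.2 fun j => ?_
    by_cases hij : i = j
    · simp [hij]
    · filter_upwards [Ioo_mem_nhdsGT (dist_pos.2 (hp.ne hij))] with r hr _ using hr.2.le
  obtain ⟨r, hr, hr'⟩ := (h.and (Ioo_mem_nhdsGT (zero_lt_one' ℝ))).exists
  exact ⟨r, hr'.1, hr'.2, hr⟩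

/-- A continuous 1-periodic function stays uniformly below any strict upper bound `M` for its
values outside an open subset of the circle. -/
theorem Function.Periodic.exists_pos_forall_le_sub {f : ℝ → ℝ} (hf : Continuous f)
    (hp : Function.Periodic f 1) {J : Set UnitAddCircle} (hJ : IsOpen J) {M : ℝ}
    (hM : ∀ y : ℝ, (y : UnitAddCircle) ∉ J → f y < M) :
    ∃ α : ℝ, 0 < α ∧ ∀ y : ℝ, (y : UnitAddCircle) ∉ J → f y ≤ M - α := by
  have hcoe : Continuous (fun y : ℝ => (y : UnitAddCircle)) := AddCircle.continuous_mk' 1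
  have hS : IsCompact (Icc (0 : ℝ) 1 ∩ {y : ℝ | (y : UnitAddCircle) ∉ J}) :=
    isCompact_Icc.inter_right (hJ.isClosed_compl.preimage hcoe)
  have hred : ∀ y : ℝ, (y : UnitAddCircle) ∉ J →
      Int.fract y ∈ Icc (0 : ℝ) 1 ∩ {y : ℝ | (y : UnitAddCircle) ∉ J} := fun y hy => by
    refine ⟨⟨Int.fract_nonneg y, (Int.fract_lt_one y).le⟩, ?_⟩
    have : ((Int.fract y : ℝ) : UnitAddCircle) = y :=
      UnitAddCircle.coe_eq_coe_iff_exists_int.2 ⟨-⌊y⌋, by push_cast; linarith [Int.self_sub_floor y]⟩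
    simpa only [mem_ofPred_eq, this] using hy
  have hfract : ∀ y : ℝ, f (Int.fract y) = f y := fun y => by
    have := hp.sub_zsmul_eq ⌊y⌋ (x := y)
    rwa [zsmul_one, Int.self_sub_floor] at this
  obtain hne | hne := (Icc (0 : ℝ) 1 ∩ {y : ℝ | (y : UnitAddCircle) ∉ J}).eq_empty_or_nonempty
  · exact ⟨1, one_pos, fun y hy => absurd (hred y hy) (by simp [hne])⟩
  · obtain ⟨z, hz, hmax⟩ := hS.exists_isMaxOn hne hf.continuousOn
    refine ⟨M - f z, sub_pos.2 (hM z hz.2), fun y hy => ?_⟩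
    have := hmax (hred y hy)
    simp only [mem_ofPred_eq, hfract] at this
    linarith

theorem Function.Periodic.exists_forall_le {f : ℝ → ℝ} (hf : Continuous f)
    (hp : Function.Periodic f 1) : ∃ x, ∀ y, f y ≤ f x := by
  obtain ⟨z, -, hmax⟩ := (isCompact_Icc (a := (0 : ℝ)) (b := 1)).exists_isMaxOn
    (nonempty_Icc.2 zero_le_one) hf.continuousOn
  refine ⟨z, fun y => ?_⟩
  obtain ⟨w, hw, hyw⟩ := hp.exists_mem_Ico₀ one_pos y
  exact hyw ▸ hmax (Ico_subset_Icc_self hw)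

section LinearFamily

variable {K : ℕ} {F : Fin K → ℝ → ℝ}

/-- Almost every parameter avoids a given hyperplane through the origin. -/
theorem ae_sum_mul_ne_zero {a : Fin K → ℝ} (ha : ∃ k, a k ≠ 0) :
    ∀ᵐ c : Fin K → ℝ, ∑ k, c k * a k ≠ 0 := by
  let L : (Fin K → ℝ) →ₗ[ℝ] ℝ := ∑ k, a k • LinearMap.proj k
  have hL : ∀ c, L c = ∑ k, c k * a k := fun c => by simp [L, mul_comm]
  have htop : LinearMap.ker L ≠ ⊤ := fun h => by
    obtain ⟨k, hk⟩ := ha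
    have h1 : L (Pi.single k 1) = 0 := by
      rw [← LinearMap.mem_ker, h]; trivial
    rw [hL] at h1
    simp [Pi.single_apply, hk] at h1
  have h0 := Measure.addHaar_submodule volume _ htop
  filter_upwards [measure_eq_zero_iff_ae_notMem.1 h0] with c hc
  rwa [← hL]

/-- For almost every parameter `c`, two maximizers of `∑ k, c k * F k` have the same image under
the family `F`. -/
theorem ae_maximizer_image_unique (hF : ∀ k, Continuous (F k))
    (hper : ∀ k, Function.Periodic (F k) 1) :
    ∀ᵐ c : Fin K → ℝ, ∀ x y : ℝ, (∀ z, ∑ k, c k * F k z ≤ ∑ k, c k * F k x) →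
      (∀ z, ∑ k, c k * F k z ≤ ∑ k, c k * F k y) → ∀ k, F k x = F k y := by
  have hexists : ∀ c : Fin K → ℝ, ∃ x, ∀ z, ∑ k, c k * F k z ≤ ∑ k, c k * F k x := fun c =>
    Function.Periodic.exists_forall_le (f := fun z => ∑ k, c k * F k z) (by fun_prop)
      (fun z => by simp [hper _ z])
  choose m hm using hexists
  have hbdd : ∀ k, ∃ M, ∀ z, |F k z| ≤ M := fun k => by
    obtain ⟨x, hx⟩ := Function.Periodic.exists_forall_le (f := fun z => |F k z|)
      (hF k).abs (fun z => by simp [hper _ z])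
    exact ⟨_, hx⟩
  choose M hM using hbdd
  let h : (Fin K → ℝ) → ℝ := fun c => ∑ k, c k * F k (m c)
  have hlip : LipschitzWith (Real.toNNReal (∑ k, M k)) h := by
    refine LipschitzWith.of_le_add_mul' _ fun c d => ?_
    have h1 : ∑ k, (c k - d k) * F k (m c) ≤ ∑ k, M k * dist c d := by
      refine Finset.sum_le_sum fun k _ => ?_
      have h2 : |c k - d k| ≤ dist c d := dist_le_pi_dist c d k
      calc (c k - d k) * F k (m c) ≤ |c k - d k| * |F k (m c)| := by
            rw [← abs_mul]; exact le_abs_self _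
        _ ≤ dist c d * M k := by gcongr; exact hM k _
        _ = M k * dist c d := mul_comm _ _
    have h3 := hm d (m c)
    simp only [sub_mul, Finset.sum_sub_distrib] at h1
    rw [← Finset.sum_mul] at h1
    change ∑ k, c k * F k (m c) ≤ ∑ k, d k * F k (m d) + _
    linarith
  filter_upwards [hlip.ae_differentiableAt] with c hc
  let ℓ : ℝ → (Fin K → ℝ) →L[ℝ] ℝ := fun x => ∑ k, F k x • ContinuousLinearMap.proj k
  have hℓ : ∀ x d, ℓ x d = ∑ k, d k * F k x := fun x d => by
    simp [ℓ, mul_comm]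
  have key : ∀ x, (∀ z, ∑ k, c k * F k z ≤ ∑ k, c k * F k x) → fderiv ℝ h c = ℓ x := by
    intro x hx
    have hmin : IsLocalMin (fun d => h d - ℓ x d) c := by
      refine Eventually.of_forall fun d => ?_
      have h1 : h c ≤ ℓ x c := by rw [hℓ]; exact hx _
      have h2 : ℓ x d ≤ h d := by rw [hℓ]; exact hm d x
      change h c - ℓ x c ≤ h d - ℓ x d
      linarith
    exact sub_eq_zero.1
      (hmin.hasFDerivAt_eq_zero (hc.hasFDerivAt.sub (ℓ x).hasFDerivAt))
  intro x y hx hy k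
  have := DFunLike.congr_fun ((key x hx).symm.trans (key y hy)) (Pi.single k 1)
  simpa [hℓ, Pi.single_apply] using this

theorem sum_mul_deriv_eq_zero_of_forall_le (hF : ∀ k, Differentiable ℝ (F k)) {c : Fin K → ℝ}
    {x : ℝ} (hx : ∀ z, ∑ k, c k * F k z ≤ ∑ k, c k * F k x) :
    ∑ k, c k * deriv (F k) x = 0 := by
  have hmax : IsLocalMax (fun z => ∑ k, c k * F k z) x := Eventually.of_forall hx
  refine hmax.hasDerivAt_eq_zero ?_
  exact HasDerivAt.fun_sum fun k _ => ((hF k x).hasDerivAt).const_mul (c k)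

end LinearFamily

theorem memSupp_of_mem_support {E : Type*} [TopologicalSpace E] [MeasurableSpace E] {μ : Measure E}
    {c : E} (hc : c ∈ μ.support) : MemSupp μ c := fun U hU hcU =>
  (Measure.mem_support_iff_forall c).1 hc U (hU.mem_nhds hcU)


/-- the separation property.  Under the embedding condition on the smooth
1-periodic potentials `F¹,…,F^K` and for `μ` a Borel probability measure on `ℝ^K` absolutely
continuous w.r.t. Lebesgue measure, there exist three pairwise disjoint open arcs `J₁,J₂,J₃`,
vectors `c¹,c²,c³ ∈ supp μ`, points `x_i ∈ J_i` and `α₀ > 0` such that each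
`F̃_i = Σ_k c^i_k F^k` attains its maximum over `ℝ/ℤ` at the unique point `x_i`, and for every
`α ∈ (0,α₀]` there is an open arc `I` with `x_i ∈ I ⊆ J_i` and `F̃_i ≤ F̃_i(x_i) − α` off `I`. -/
theorem stmt2 (K : ℕ) (hK : 1 ≤ K) (F : Fin K → ℝ → ℝ)
    (hsmooth : ∀ k, ContDiff ℝ (⊤ : ℕ∞) (F k)) (hper : ∀ k, Function.Periodic (F k) 1)
    (hinj : ∀ x y : ℝ, (∀ k, F k x = F k y) → ∃ m : ℤ, x - y = (m : ℝ))
    (hder : ∀ x : ℝ, ∃ k, deriv (F k) x ≠ 0)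
    (μ : Measure (Fin K → ℝ)) [IsProbabilityMeasure μ] (hac : μ ≪ volume) :
    ∃ (J : Fin 3 → Set UnitAddCircle) (c : Fin 3 → Fin K → ℝ) (x : Fin 3 → ℝ) (α₀ : ℝ),
      0 < α₀ ∧
      (∀ i, IsOpenArc (J i)) ∧
      (∀ i i', i ≠ i' → Disjoint (J i) (J i')) ∧
      (∀ i, MemSupp μ (c i)) ∧
      (∀ i, ((x i : ℝ) : UnitAddCircle) ∈ J i) ∧
      (∀ i, ∀ y : ℝ, ∑ k, c i k * F k y ≤ ∑ k, c i k * F k (x i)) ∧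
      (∀ i, ∀ y : ℝ, (∑ k, c i k * F k y = ∑ k, c i k * F k (x i)) →
          ∃ m : ℤ, y - x i = (m : ℝ)) ∧
      (∀ i, ∀ α : ℝ, 0 < α → α ≤ α₀ →
        ∃ I : Set UnitAddCircle, IsOpenArc I ∧ ((x i : ℝ) : UnitAddCircle) ∈ I ∧ I ⊆ J i ∧
          ∀ y : ℝ, ((y : ℝ) : UnitAddCircle) ∉ I →
            ∑ k, c i k * F k y ≤ (∑ k, c i k * F k (x i)) - α) := by
  have hF : ∀ k, Differentiable ℝ (F k) := fun k => (hsmooth k).differentiable (by simp)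
  have hcont : ∀ k, Continuous (F k) := fun k => (hF k).continuous
  have hperc : ∀ c : Fin K → ℝ, Function.Periodic (fun z => ∑ k, c k * F k z) 1 := fun c z => by
    simp [hper _ z]
  have htransfer : ∀ (c : Fin K → ℝ) (x y : ℝ), (x : UnitAddCircle) = y →
      ∑ k, c k * F k x = ∑ k, c k * F k y := fun c x y hxy => by
    obtain ⟨m, hm⟩ := UnitAddCircle.coe_eq_coe_iff_exists_int.1 hxy
    have := (hperc c).sub_zsmul_eq m (x := x)
    simp only [zsmul_eq_mul, mul_one, ← hm, sub_sub_cancel] at this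
    exact this.symm
  have hgood : ∀ᵐ c ∂μ, c ∈ μ.support ∧ ∃ x : ℝ, (∀ z, ∑ k, c k * F k z ≤ ∑ k, c k * F k x) ∧
      ∀ y : ℝ, ∑ k, c k * F k y = ∑ k, c k * F k x → ∃ m : ℤ, y - x = m := by
    filter_upwards [Measure.support_mem_ae (μ := μ),
      hac.ae_le (ae_maximizer_image_unique hcont hper)] with c hc hu
    obtain ⟨x, hx⟩ := Function.Periodic.exists_forall_le
      (f := fun z => ∑ k, c k * F k z) (by fun_prop) (hperc c)
    exact ⟨hc, x, hx, fun y hy => hinj y x (hu y x (fun z => (hx z).trans_eq hy.symm) hx)⟩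
  have hnd : ∀ x : ℝ, ∀ᵐ c ∂μ, ∑ k, c k * deriv (F k) x ≠ 0 := fun x =>
    hac.ae_le (ae_sum_mul_ne_zero (hder x))
  have hne : ∀ (c : Fin K → ℝ) (x y : ℝ), ∑ k, c k * deriv (F k) x ≠ 0 →
      (∀ z, ∑ k, c k * F k z ≤ ∑ k, c k * F k y) → (x : UnitAddCircle) ≠ y :=
    fun c x y hd hy hxy => hd (sum_mul_deriv_eq_zero_of_forall_le hF
      fun z => (hy z).trans_eq (htransfer c x y hxy).symm)
  obtain ⟨c₁, hc₁, x₁, hx₁, hu₁⟩ := hgood.exists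
  obtain ⟨c₂, ⟨hc₂, x₂, hx₂, hu₂⟩, h₁₂⟩ := (hgood.and (hnd x₁)).exists
  obtain ⟨c₃, ⟨hc₃, x₃, hx₃, hu₃⟩, h₁₃, h₂₃⟩ := (hgood.and ((hnd x₁).and (hnd x₂))).exists
  replace h₁₂ := hne _ _ _ h₁₂ hx₂
  replace h₁₃ := hne _ _ _ h₁₃ hx₃
  replace h₂₃ := hne _ _ _ h₂₃ hx₃
  obtain ⟨c, x, hc, hx, hu, hxinj⟩ : ∃ (c : Fin 3 → Fin K → ℝ) (x : Fin 3 → ℝ),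
      (∀ i, c i ∈ μ.support) ∧
      (∀ i, ∀ y : ℝ, ∑ k, c i k * F k y ≤ ∑ k, c i k * F k (x i)) ∧
      (∀ i, ∀ y : ℝ, (∑ k, c i k * F k y = ∑ k, c i k * F k (x i)) →
          ∃ m : ℤ, y - x i = (m : ℝ)) ∧
      Function.Injective (fun i => (x i : UnitAddCircle)) := by
    refine ⟨![c₁, c₂, c₃], ![x₁, x₂, x₃], ?_, ?_, ?_, ?_⟩
    · intro i; fin_cases i <;> assumption
    · intro i; fin_cases i <;> assumption
    · intro i; fin_cases i <;> assumption
    · intro i j hij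
      fin_cases i <;> fin_cases j <;> first | rfl | exact absurd hij ‹_› | exact absurd hij.symm ‹_›
  obtain ⟨r, hr0, hr1, hr⟩ := hxinj.exists_pos_le_dist
  let J : Fin 3 → Set UnitAddCircle := fun i =>
    (fun x : ℝ => (x : UnitAddCircle)) '' Ioo (x i - r / 2) (x i + r / 2)
  have hmem : ∀ i, (x i : UnitAddCircle) ∈ J i := fun i =>
    ⟨x i, ⟨by linarith, by linarith⟩, rfl⟩
  have harc : ∀ i, IsOpenArc (J i) := fun i => ⟨x i - r / 2, r, hr1, by
    rw [show x i - r / 2 + r = x i + r / 2 by ring]⟩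
  have hgap : ∀ i, ∃ α : ℝ, 0 < α ∧ ∀ y : ℝ, (y : UnitAddCircle) ∉ J i →
      ∑ k, c i k * F k y ≤ ∑ k, c i k * F k (x i) - α := fun i => by
    refine Function.Periodic.exists_pos_forall_le_sub (f := fun z => ∑ k, c i k * F k z)
      (by fun_prop) (hperc _) (UnitAddCircle.isOpen_coe_image_Ioo _ _) fun y hy => ?_
    refine lt_of_le_of_ne (hx i y) fun heq => hy ?_
    rw [UnitAddCircle.coe_eq_coe_iff_exists_int.2 (hu i y heq)]
    exact hmem i
  choose α hα0 hα using hgap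
  refine ⟨J, c, x, Finset.univ.inf' Finset.univ_nonempty α, ?_, harc, ?_,
    fun i => memSupp_of_mem_support (hc i), hmem, hx, hu, fun i β _ hβ => ?_⟩
  · exact (Finset.lt_inf'_iff _).2 fun i _ => hα0 i
  · exact fun i j hij => (Metric.ball_disjoint_ball (by linarith [hr i j hij])).mono
      (UnitAddCircle.coe_image_Ioo_subset_ball _ _) (UnitAddCircle.coe_image_Ioo_subset_ball _ _)
  · have := hβ.trans (Finset.inf'_le α (Finset.mem_univ i))
    exact ⟨J i, harc i, hmem i, Subset.rfl, fun y hy => (hα i y hy).trans (by linarith)⟩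
end

section
/- There exist three pairwise disjoint open arcs J₁, J₂, J₃ ⊆ ℝ/ℤ, vectors c¹, c², c³ ∈ ℝ^K, points x_i ∈ J_i (i = 1,2,3), and α₀ > 0 such that for each i the function F̃_i = Σ_{k=1}^K c^i_k F^k attains its maximum over ℝ/ℤ at the unique point x_i, and for every α ∈ (0, α₀] there is an open arc I with x_i ∈ I ⊆ J_i and F̃_i(y) ≤ F̃_i(x_i) − α for every y ∈ ℝ/ℤ ∖ I. -/
open scoped RealInnerProductSpace

/-- A point `A` of a set in an inner product space that is farthest from some point `p ≠ A` is
exposed by the functional `⟪A - p, ·⟫`. -/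
theorem inner_lt_inner_of_farthest {V : Type*} [NormedAddCommGroup V] [InnerProductSpace ℝ V]
    {p A z : V} (h : ‖z - p‖ ≤ ‖A - p‖) (hz : z ≠ A) : ⟪A - p, z⟫ < ⟪A - p, A⟫ := by
  have h1 : 0 < ‖(A - p) - (z - p)‖ ^ 2 := by
    have : (A - p) - (z - p) ≠ 0 := by
      rw [sub_sub_sub_cancel_right]
      exact sub_ne_zero.2 hz.symm
    positivity
  rw [norm_sub_sq_real] at h1
  have h2 : ‖z - p‖ ^ 2 ≤ ‖A - p‖ ^ 2 := by gcongr
  have h3 : ⟪A - p, A - p⟫ = ‖A - p‖ ^ 2 := real_inner_self_eq_norm_sq _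
  rw [inner_sub_right] at h1 h3
  linarith

/-- A continuous `1`-periodic real function is not injective modulo `1`. -/
theorem Function.Periodic.not_injective_mod_one {f : ℝ → ℝ} (hf : Continuous f)
    (hper : Function.Periodic f 1) : ¬ ∀ x y : ℝ, f x = f y → ∃ m : ℤ, x - y = (m : ℝ) := by
  intro hinj
  have h01 : f 1 = f 0 := by simpa using hper 0
  have no_int : ∀ x y : ℝ, 0 < x - y → x - y < 1 → f x ≠ f y := by
    intro x y h0 h1 h
    obtain ⟨m, hm⟩ := hinj x y h
    rw [hm] at h0 h1
    have h0' : (0 : ℤ) < m := by exact_mod_cast h0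
    have h1' : m < (1 : ℤ) := by exact_mod_cast h1
    omega
  have hne : f (1 / 2) ≠ f 0 := no_int _ _ (by norm_num) (by norm_num)
  obtain ⟨u, ⟨hu0, hu1⟩, hu⟩ : (f 0 + f (1 / 2)) / 2 ∈ f '' Set.uIcc 0 (1 / 2) := by
    refine intermediate_value_uIcc hf.continuousOn ?_
    rw [Set.mem_uIcc]
    rcases le_total (f 0) (f (1 / 2)) with h | h
    · left; constructor <;> linarith
    · right; constructor <;> linarith
  obtain ⟨v, ⟨hv0, hv1⟩, hv⟩ : (f 0 + f (1 / 2)) / 2 ∈ f '' Set.uIcc (1 / 2) 1 := by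
    refine intermediate_value_uIcc hf.continuousOn ?_
    rw [Set.mem_uIcc, h01]
    rcases le_total (f 0) (f (1 / 2)) with h | h
    · right; constructor <;> linarith
    · left; constructor <;> linarith
  norm_num at hu0 hu1 hv0 hv1
  have hu2 : u ≠ 1 / 2 := by
    rintro rfl
    exact hne (by linarith)
  have hv2 : v ≠ 1 := by
    rintro rfl
    exact hne (by linarith)
  have hu3 : u < 1 / 2 := lt_of_le_of_ne hu1 hu2
  have hv3 : v < 1 := lt_of_le_of_ne hv1 hv2
  exact no_int v u (by linarith) (by linarith) (hv.trans hu.symm)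

theorem Function.Periodic.exists_forall_norm_sub_le {V : Type*} [NormedAddCommGroup V]
    {γ : ℝ → V} (hγ : Continuous γ) (hper : Function.Periodic γ 1) (p : V) :
    ∃ x, ∀ y, ‖γ y - p‖ ≤ ‖γ x - p‖ := by
  obtain ⟨x, -, hx⟩ := (isCompact_Icc (a := (0 : ℝ)) (b := 1)).exists_isMaxOn
    ⟨0, by simp⟩ ((hγ.sub continuous_const).norm (f := fun y => γ y - p)).continuousOn
  refine ⟨x, fun y => ?_⟩
  obtain ⟨z, hz, hzy⟩ := hper.exists_mem_Ico₀ one_pos y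
  rw [hzy]
  exact hx ⟨hz.1, hz.2.le⟩

/-- A simple closed curve in a real inner product space has three distinct exposed points. -/
theorem exists_three_exposed_points {V : Type*} [NormedAddCommGroup V] [InnerProductSpace ℝ V]
    {γ : ℝ → V} (hγ : Continuous γ) (hper : Function.Periodic γ 1)
    (hinj : ∀ x y : ℝ, γ x = γ y → ∃ m : ℤ, x - y = (m : ℝ)) :
    ∃ (x : Fin 3 → ℝ) (c : Fin 3 → V), (∀ i j, i ≠ j → γ (x i) ≠ γ (x j)) ∧
      ∀ i y, γ y ≠ γ (x i) → ⟪c i, γ y⟫ < ⟪c i, γ (x i)⟫ := by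
  have far := hper.exists_forall_norm_sub_le hγ
  obtain ⟨a, ha⟩ := far (γ 0)
  obtain ⟨b, hb⟩ := far (γ a)
  have hab : γ b ≠ γ a := by
    intro h
    have key : ∀ y, γ y = γ a := fun y => by
      have := hb y
      rw [h, sub_self, norm_zero] at this
      exact sub_eq_zero.1 (norm_le_zero_iff.1 this)
    refine Function.Periodic.not_injective_mod_one (f := fun _ => 0) continuous_const
      (fun _ => rfl) fun x y _ => hinj x y ((key x).trans (key y).symm)
  set w := γ b - γ a with hw
  have hw0 : w ≠ 0 := sub_ne_zero.2 hab
  have hww : ⟪w, w⟫ ≠ 0 := inner_self_ne_zero.2 hw0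
  obtain ⟨d, hd⟩ : ∃ d, γ d - γ a - (⟪w, γ d - γ a⟫ / ⟪w, w⟫) • w ≠ 0 := by
    by_contra! hline
    refine Function.Periodic.not_injective_mod_one (f := fun y => ⟪w, γ y - γ a⟫)
      (by fun_prop) (fun y => by simp only [hper y]) fun x y hxy => hinj x y ?_
    have hx := hline x
    have hy := hline y
    rw [hxy] at hx
    exact sub_left_injective (sub_left_injective (hx.trans hy.symm))
  set h := γ d - γ a - (⟪w, γ d - γ a⟫ / ⟪w, w⟫) • w with hh
  have hhw : ⟪h, w⟫ = 0 := by
    rw [real_inner_comm, hh, inner_sub_right, inner_smul_right]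
    field_simp
    ring
  have hhd : ⟪h, γ d - γ a⟫ = ⟪h, h⟫ := by
    have : γ d - γ a = h + (⟪w, γ d - γ a⟫ / ⟪w, w⟫) • w := by rw [hh]; abel
    rw [this, inner_add_right, inner_smul_right, hhw, mul_zero, add_zero]
  have hpos : 0 < ⟪h, h⟫ := real_inner_self_pos.2 hd
  set t := (‖w‖ ^ 2 + 1) / ⟪h, h⟫ with ht
  have htpos : 0 < t := by positivity
  have hth : t * ⟪h, h⟫ = ‖w‖ ^ 2 + 1 := by rw [ht]; field_simp
  obtain ⟨e, he⟩ := far (γ a - t • h)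
  have expand : ∀ z : V, ‖z - (γ a - t • h)‖ ^ 2
      = ‖z - γ a‖ ^ 2 + 2 * (t * ⟪h, z - γ a⟫) + ‖t • h‖ ^ 2 := fun z => by
    rw [show z - (γ a - t • h) = (z - γ a) + t • h by abel, norm_add_sq_real, inner_smul_right,
      real_inner_comm]
  have hed : ‖γ d - (γ a - t • h)‖ ^ 2 ≤ ‖γ e - (γ a - t • h)‖ ^ 2 := by
    gcongr
    exact he d
  rw [expand, expand, hhd, hth] at hed
  have hea : γ e ≠ γ a := by
    intro h'
    rw [h', sub_self, inner_zero_right, norm_zero] at hed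
    nlinarith [sq_nonneg ‖w‖, sq_nonneg ‖γ d - γ a‖]
  have heb : γ e ≠ γ b := by
    intro h'
    rw [h', ← hw, hhw] at hed
    nlinarith [sq_nonneg ‖w‖, sq_nonneg ‖γ d - γ a‖]
  refine ⟨![a, b, e], ![γ a - γ 0, γ b - γ a, γ e - (γ a - t • h)], ?_, ?_⟩
  · intro i j hij
    fin_cases i <;> fin_cases j <;>
      simp_all [hab.symm, hea.symm, heb.symm]
  · intro i y hy
    fin_cases i
    · exact inner_lt_inner_of_farthest (ha y) hy
    · exact inner_lt_inner_of_farthest (hb y) hy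
    · exact inner_lt_inner_of_farthest (he y) hy

theorem exists_gap_off_open {f : ℝ → ℝ} (hf : Continuous f) (hper : Function.Periodic f 1)
    {J : Set UnitAddCircle} (hJ : IsOpen J) {M : ℝ}
    (hlt : ∀ y : ℝ, (y : UnitAddCircle) ∉ J → f y < M) :
    ∃ α, 0 < α ∧ ∀ y : ℝ, (y : UnitAddCircle) ∉ J → f y ≤ M - α := by
  set S : Set ℝ := Set.Icc 0 1 ∩ (fun y : ℝ => (y : UnitAddCircle)) ⁻¹' Jᶜ with hS
  have hScomp : IsCompact S := isCompact_Icc.inter_right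
    (hJ.isClosed_compl.preimage (AddCircle.continuous_mk' 1))
  have red : ∀ y : ℝ, (y : UnitAddCircle) ∉ J → ∃ z ∈ S, f y = f z := by
    intro y hy
    have hz : (Int.fract y : ℝ) = y - (⌊y⌋ : ℤ) • (1 : ℝ) := by
      rw [zsmul_one, Int.self_sub_floor]
    refine ⟨Int.fract y, ⟨⟨Int.fract_nonneg y, (Int.fract_lt_one y).le⟩, ?_⟩, ?_⟩
    · have : ((Int.fract y : ℝ) : UnitAddCircle) = (y : UnitAddCircle) := by
        rw [hz, AddCircle.coe_sub, AddCircle.coe_zsmul, AddCircle.coe_period, smul_zero, sub_zero]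
      simpa [this] using hy
    · rw [hz, hper.sub_zsmul_eq]
  rcases S.eq_empty_or_nonempty with hemp | hne
  · refine ⟨1, one_pos, fun y hy => ?_⟩
    obtain ⟨z, hz, -⟩ := red y hy
    simp [hemp] at hz
  · obtain ⟨z, hz, hmax⟩ := hScomp.exists_isMaxOn hne hf.continuousOn
    refine ⟨M - f z, sub_pos.2 (hlt z hz.2), fun y hy => ?_⟩
    obtain ⟨u, hu, hyu⟩ := red y hy
    have : f u ≤ f z := hmax hu
    linarith

theorem exists_pairwise_disjoint_open_arcs {n : ℕ} (x : Fin n → ℝ)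
    (hx : ∀ i j, i ≠ j → (x i : UnitAddCircle) ≠ (x j : UnitAddCircle)) :
    ∃ J : Fin n → Set UnitAddCircle, (∀ i, IsOpenArc (J i)) ∧ (∀ i, IsOpen (J i)) ∧
      (∀ i j, i ≠ j → Disjoint (J i) (J j)) ∧ ∀ i, (x i : UnitAddCircle) ∈ J i := by
  obtain ⟨δ, hδ, hδ1, hsep⟩ : ∃ δ : ℝ, 0 < δ ∧ δ < 1 / 2 ∧
      ∀ i j, i ≠ j → 2 * δ ≤ ‖(x i : UnitAddCircle) - (x j : UnitAddCircle)‖ := by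
    have hev : ∀ᶠ δ : ℝ in nhdsWithin 0 (Set.Ioi 0), ∀ i j, i ≠ j →
        2 * δ ≤ ‖(x i : UnitAddCircle) - (x j : UnitAddCircle)‖ := by
      simp only [Filter.eventually_all]
      intro i j hij
      have hpos : 0 < ‖(x i : UnitAddCircle) - (x j : UnitAddCircle)‖ / 2 := by
        have := norm_pos_iff.2 (sub_ne_zero.2 (hx i j hij))
        positivity
      filter_upwards [Ioo_mem_nhdsGT hpos] with δ hδ
      linarith [hδ.2]
    obtain ⟨δ, h1, h2⟩ := (hev.and (Ioo_mem_nhdsGT (show (0 : ℝ) < 1 / 2 by norm_num))).exists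
    exact ⟨δ, h2.1, h2.2, h1⟩
  refine ⟨fun i => (fun y : ℝ => (y : UnitAddCircle)) '' Set.Ioo (x i - δ) (x i - δ + 2 * δ),
    fun i => ⟨_, _, by linarith, rfl⟩, fun i => ?_, fun i j hij => ?_,
    fun i => ⟨x i, ⟨by linarith, by linarith⟩, rfl⟩⟩
  · exact QuotientAddGroup.isOpenMap_coe _ isOpen_Ioo
  · rw [Set.disjoint_left]
    rintro _ ⟨u, hu, rfl⟩ ⟨v, hv, huv⟩
    have near : ∀ (k : Fin n) (z : ℝ), z ∈ Set.Ioo (x k - δ) (x k - δ + 2 * δ) →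
        ‖(z : UnitAddCircle) - (x k : UnitAddCircle)‖ < δ := by
      intro k z hz
      rw [← AddCircle.coe_sub]
      refine lt_of_le_of_lt QuotientAddGroup.norm_mk_le_norm ?_
      rw [Real.norm_eq_abs, abs_lt]
      constructor <;> linarith [hz.1, hz.2]
    have h1 := near i u hu
    have h2 := near j v hv
    dsimp only at huv
    rw [huv] at h2
    have h3 := hsep i j hij
    have h4 := norm_sub_le_norm_sub_add_norm_sub (x i : UnitAddCircle) (u : UnitAddCircle)
      (x j : UnitAddCircle)
    rw [norm_sub_rev (x i : UnitAddCircle) (u : UnitAddCircle)] at h4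
    linarith

theorem UnitAddCircle.coe_eq_coe_iff {u v : ℝ} :
    (u : UnitAddCircle) = v ↔ ∃ m : ℤ, u - v = (m : ℝ) := by
  rw [← sub_eq_zero, ← AddCircle.coe_sub, AddCircle.coe_eq_zero_iff]
  simp only [zsmul_one, eq_comm]

/-- the separation property (deterministic version).  Under the embedding
condition on the smooth 1-periodic potentials `F¹,…,F^K`, there exist three pairwise disjoint
open arcs `J₁,J₂,J₃`, vectors `c¹,c²,c³ ∈ ℝ^K`, points `x_i ∈ J_i` and `α₀ > 0` such that each
`F̃_i = Σ_k c^i_k F^k` attains its maximum over `ℝ/ℤ` at the unique point `x_i`, and for every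
`α ∈ (0,α₀]` there is an open arc `I` with `x_i ∈ I ⊆ J_i` and `F̃_i ≤ F̃_i(x_i) − α` off `I`. -/
theorem stmt3 (K : ℕ) (hK : 1 ≤ K) (F : Fin K → ℝ → ℝ)
    (hsmooth : ∀ k, ContDiff ℝ (⊤ : ℕ∞) (F k)) (hper : ∀ k, Function.Periodic (F k) 1)
    (hinj : ∀ x y : ℝ, (∀ k, F k x = F k y) → ∃ m : ℤ, x - y = (m : ℝ))
    (hder : ∀ x : ℝ, ∃ k, deriv (F k) x ≠ 0) :
    ∃ (J : Fin 3 → Set UnitAddCircle) (c : Fin 3 → Fin K → ℝ) (x : Fin 3 → ℝ) (α₀ : ℝ),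
      0 < α₀ ∧
      (∀ i, IsOpenArc (J i)) ∧
      (∀ i i', i ≠ i' → Disjoint (J i) (J i')) ∧
      (∀ i, ((x i : ℝ) : UnitAddCircle) ∈ J i) ∧
      (∀ i, ∀ y : ℝ, ∑ k, c i k * F k y ≤ ∑ k, c i k * F k (x i)) ∧
      (∀ i, ∀ y : ℝ, (∑ k, c i k * F k y = ∑ k, c i k * F k (x i)) →
          ∃ m : ℤ, y - x i = (m : ℝ)) ∧
      (∀ i, ∀ α : ℝ, 0 < α → α ≤ α₀ →
        ∃ I : Set UnitAddCircle, IsOpenArc I ∧ ((x i : ℝ) : UnitAddCircle) ∈ I ∧ I ⊆ J i ∧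
          ∀ y : ℝ, ((y : ℝ) : UnitAddCircle) ∉ I →
            ∑ k, c i k * F k y ≤ (∑ k, c i k * F k (x i)) - α) := by
  let γ : ℝ → EuclideanSpace ℝ (Fin K) := fun y => WithLp.toLp 2 fun k => F k y
  have hcont : ∀ k, Continuous (F k) := fun k => (hsmooth k).continuous
  have hγ : Continuous γ := by
    refine (PiLp.continuous_toLp 2 _).comp (continuous_pi hcont)
  have hγper : Function.Periodic γ 1 := fun y => by simp only [γ, hper _ y]
  have hγinj : ∀ x y : ℝ, γ x = γ y → ∃ m : ℤ, x - y = (m : ℝ) := fun x y h =>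
    hinj x y fun k => congrArg (fun v : EuclideanSpace ℝ (Fin K) => v k) h
  obtain ⟨x, c, hxne, hexp⟩ := exists_three_exposed_points hγ hγper hγinj
  have hinner : ∀ (v : EuclideanSpace ℝ (Fin K)) (y : ℝ), ⟪v, γ y⟫ = ∑ k, v k * F k y := by
    intro v y
    simp [γ, PiLp.inner_apply, mul_comm]
  simp only [hinner] at hexp
  have hcoe : ∀ u v : ℝ, (u : UnitAddCircle) = v → γ u = γ v := by
    intro u v huv
    obtain ⟨m, hm⟩ := UnitAddCircle.coe_eq_coe_iff.1 huv
    rw [show u = v + m by linarith, show (m : ℝ) = m • (1 : ℝ) by simp]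
    exact hγper.zsmul m v
  obtain ⟨J, hJarc, hJopen, hJdisj, hxJ⟩ := exists_pairwise_disjoint_open_arcs x
    fun i j hij h => hxne i j hij (hcoe _ _ h)
  have hgap : ∀ i, ∃ α, 0 < α ∧ ∀ y : ℝ, (y : UnitAddCircle) ∉ J i →
      ∑ k, c i k * F k y ≤ ∑ k, c i k * F k (x i) - α := by
    intro i
    refine exists_gap_off_open (f := fun y => ∑ k, c i k * F k y) (by fun_prop)
      (fun y => by simp only [hper _ y]) (hJopen i) fun y hy => hexp i y fun h => hy ?_
    rw [UnitAddCircle.coe_eq_coe_iff.2 (hγinj _ _ h)]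
    exact hxJ i
  choose α hα hαgap using hgap
  refine ⟨J, fun i k => c i k, x, Finset.univ.inf' Finset.univ_nonempty α,
    (Finset.lt_inf'_iff _).2 fun i _ => hα i, hJarc, hJdisj, hxJ, fun i y => ?_, fun i y h => ?_,
    fun i β _ hβ => ⟨J i, hJarc i, hxJ i, subset_rfl, fun y hy => (hαgap i y hy).trans ?_⟩⟩
  · by_cases h : γ y = γ (x i)
    · rw [← hinner, ← hinner, h]
    · exact (hexp i y h).le
  · by_contra hm
    exact (hexp i y fun h' => hm (hγinj _ _ h')).ne h
  · linarith [hβ.trans (Finset.inf'_le α (Finset.mem_univ i))]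
end

section
/- If the map from ℝ/ℤ to ℝ^K, x ↦ (F¹(x),…,F^K(x)), is injective, then for Lebesgue-almost every c ∈ ℝ^K the function x ↦ Σ_{j=1}^K c_j F^j(x) attains its maximum over ℝ/ℤ at exactly one point, i.e. its set of maximizers in ℝ/ℤ is a singleton. -/
open MeasureTheory

/-- The support function `c ↦ sup_{ℓ ∈ S} ℓ c` of a bounded nonempty set of continuous linear
functionals is Lipschitz. -/
theorem exists_lipschitzWith_iSup_apply {E : Type*} [NormedAddCommGroup E] [NormedSpace ℝ E]
    {S : Set (E →L[ℝ] ℝ)} (hne : S.Nonempty) (hS : Bornology.IsBounded S) :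
    ∃ C : NNReal, LipschitzWith C (fun c : E => ⨆ ℓ : S, (ℓ : E →L[ℝ] ℝ) c) ∧
      ∀ c : E, BddAbove (Set.range fun ℓ : S => (ℓ : E →L[ℝ] ℝ) c) := by
  obtain ⟨M, hM0, hM⟩ := hS.exists_pos_norm_le
  have : Nonempty S := hne.to_subtype
  have hle (ℓ : S) (c : E) : (ℓ : E →L[ℝ] ℝ) c ≤ M * ‖c‖ :=
    (le_abs_self _).trans ((ℓ : E →L[ℝ] ℝ).le_of_opNorm_le (hM ℓ ℓ.2) c)
  have hbdd (c : E) : BddAbove (Set.range fun ℓ : S => (ℓ : E →L[ℝ] ℝ) c) :=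
    ⟨M * ‖c‖, by rintro _ ⟨ℓ, rfl⟩; exact hle ℓ c⟩
  refine ⟨M.toNNReal, LipschitzWith.of_le_add_mul _ fun c d => ciSup_le fun ℓ => ?_, hbdd⟩
  have h₁ := le_ciSup (hbdd d) ℓ
  have h₂ := hle ℓ (c - d)
  rw [map_sub] at h₂
  rw [Real.coe_toNNReal _ hM0.le, dist_eq_norm]
  linarith

/-- For a compact nonempty set `S` of linear functionals on a finite-dimensional space, almost
every vector `c` has a unique `ℓ ∈ S` that maximizes `ℓ c`. -/
theorem ae_existsUnique_isMaxOn_apply {E : Type*} [NormedAddCommGroup E] [NormedSpace ℝ E]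
    [FiniteDimensional ℝ E] [MeasurableSpace E] [BorelSpace E] (μ : Measure E)
    [μ.IsAddHaarMeasure] {S : Set (E →L[ℝ] ℝ)} (hne : S.Nonempty) (hS : IsCompact S) :
    ∀ᵐ c ∂μ, ∃! ℓ : E →L[ℝ] ℝ, ℓ ∈ S ∧ IsMaxOn (fun m : E →L[ℝ] ℝ => m c) S ℓ := by
  obtain ⟨C, hC, hbdd⟩ := exists_lipschitzWith_iSup_apply hne hS.isBounded
  have : Nonempty S := hne.to_subtype
  filter_upwards [hC.ae_differentiableAt (μ := μ)] with c hc
  have hderiv (ℓ : E →L[ℝ] ℝ) (hℓ : ℓ ∈ S) (hmax : IsMaxOn (fun m : E →L[ℝ] ℝ => m c) S ℓ) :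
      fderiv ℝ (fun c : E => ⨆ ℓ : S, (ℓ : E →L[ℝ] ℝ) c) c = ℓ := by
    have hmin : IsLocalMin (fun d : E => (⨆ m : S, (m : E →L[ℝ] ℝ) d) - ℓ d) c := by
      refine Filter.Eventually.of_forall fun d => ?_
      have h₁ : (⨆ m : S, (m : E →L[ℝ] ℝ) c) ≤ ℓ c := ciSup_le fun m => hmax m.2
      have h₂ := le_ciSup (hbdd d) ⟨ℓ, hℓ⟩
      dsimp only at h₂ ⊢
      linarith
    exact sub_eq_zero.mp (hmin.hasFDerivAt_eq_zero (hc.hasFDerivAt.sub ℓ.hasFDerivAt))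
  obtain ⟨ℓ, hℓ, hmax⟩ := hS.exists_isMaxOn hne
    (f := fun m : E →L[ℝ] ℝ => m c) (by fun_prop)
  exact ⟨ℓ, ⟨hℓ, hmax⟩, fun m hm => (hderiv m hm.1 hm.2).symm.trans (hderiv ℓ hℓ hmax)⟩

/-- if the continuous 1-periodic functions `F¹,…,F^K` give an injective map of the
circle `ℝ/ℤ` into `ℝ^K`, then for Lebesgue-almost every `c ∈ ℝ^K` the function
`x ↦ Σ_j c_j F^j(x)` attains its maximum over `ℝ/ℤ` at exactly one point: its set of
maximizers in `ℝ/ℤ` is a singleton. -/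
theorem stmt8 (K : ℕ) (hK : 1 ≤ K) (F : Fin K → ℝ → ℝ)
    (hcont : ∀ k, Continuous (F k)) (hper : ∀ k, Function.Periodic (F k) 1)
    (hinj : ∀ x y : ℝ, (∀ k, F k x = F k y) → ∃ m : ℤ, x - y = (m : ℝ)) :
    ∀ᵐ c : Fin K → ℝ ∂volume, ∃ p : UnitAddCircle,
      {q : UnitAddCircle | ∃ x : ℝ, q = (x : UnitAddCircle) ∧
          ∀ y : ℝ, ∑ k, c k * F k y ≤ ∑ k, c k * F k x} = {p} := by
  let L : ℝ → (Fin K → ℝ) →L[ℝ] ℝ := fun x => ∑ k, F k x • ContinuousLinearMap.proj k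
  have hL (x : ℝ) (c : Fin K → ℝ) : L x c = ∑ k, c k * F k x := by
    simp [L, mul_comm]
  have hLcont : Continuous L :=
    continuous_finsetSum _ fun k _ => (hcont k).smul continuous_const
  have hLper : Function.Periodic L 1 := fun x => by simp only [L, hper _ x]
  have hLinj (x y : ℝ) (h : L x = L y) : (x : UnitAddCircle) = y := by
    obtain ⟨m, hm⟩ := hinj x y fun k => by
      have := congrArg (fun ℓ : (Fin K → ℝ) →L[ℝ] ℝ => ℓ (Pi.single k 1)) h
      simpa [hL, Pi.single_apply] using this
    rw [← sub_eq_zero, ← AddCircle.coe_sub, AddCircle.coe_eq_zero_iff]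
    exact ⟨m, by simp [hm]⟩
  filter_upwards [ae_existsUnique_isMaxOn_apply volume (Set.range_nonempty L)
    (hLper.compact_of_continuous one_ne_zero hLcont)] with c hc
  obtain ⟨_, ⟨⟨x, rfl⟩, hmax⟩, huniq⟩ := hc
  refine ⟨x, Set.eq_singleton_iff_unique_mem.mpr ⟨⟨x, rfl, fun y => ?_⟩, ?_⟩⟩
  · simpa only [hL] using isMaxOn_iff.mp hmax (L y) ⟨y, rfl⟩
  · rintro _ ⟨y, rfl, hy⟩
    refine hLinj y x (huniq (L y) ⟨⟨y, rfl⟩, isMaxOn_iff.mpr ?_⟩)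
    rintro _ ⟨z, rfl⟩
    simpa only [hL] using hy z
end

section
/- Let b ∈ ℝ, ε ∈ (0,1), and let N', N be positive integers with N'·⌈1/ε⌉ ≤ N. Then there exist integers 0 = n₀ < n₁ < ⋯ < n_{N'−1} ≤ N−1 such that for all 0 ≤ j, j' ≤ N'−1 the distance in ℝ/ℤ between b·n_j and b·n_{j'} is at most ε. -/
/-- Two reals whose difference is within `ε` of an integer are `ε`-close on the circle. -/
theorem UnitAddCircle.dist_coe_le_of_abs_sub_sub_intCast_le {x y ε : ℝ} (k : ℤ)
    (h : |x - y - k| ≤ ε) : dist (x : UnitAddCircle) (y : UnitAddCircle) ≤ ε := by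
  rw [dist_eq_norm, ← AddCircle.coe_sub, UnitAddCircle.norm_eq]
  exact (round_le _ k).trans h

/-- Reals whose fractional parts lie in the same one of `M` equal boxes differ by at most `1 / M`
modulo an integer. -/
theorem abs_sub_sub_floor_sub_floor_le {x y : ℝ} {M : ℕ} (hM : 0 < M)
    (h : ⌊M * Int.fract x⌋₊ = ⌊M * Int.fract y⌋₊) :
    |x - y - ((⌊x⌋ - ⌊y⌋ : ℤ) : ℝ)| ≤ 1 / M := by
  have hM' : (0 : ℝ) < M := by exact_mod_cast hM
  have hx := Nat.floor_le (mul_nonneg hM'.le (Int.fract_nonneg x))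
  have hy := Nat.floor_le (mul_nonneg hM'.le (Int.fract_nonneg y))
  have hx' := Nat.lt_floor_add_one (M * Int.fract x)
  have hy' := Nat.lt_floor_add_one (M * Int.fract y)
  rw [h] at hx hx'
  have key : x - y - ((⌊x⌋ - ⌊y⌋ : ℤ) : ℝ) = Int.fract x - Int.fract y := by
    simp only [Int.fract]
    push_cast
    ring
  rw [key, le_div_iff₀ hM', ← Nat.abs_cast M, ← abs_mul, abs_le]
  constructor <;> linarith


/-- a pigeonhole principle on the circle.  For `b ∈ ℝ`, `ε ∈ (0,1)` and positive
integers `N', N` with `N'·⌈1/ε⌉ ≤ N`, there exist integers `0 = n₀ < n₁ < ⋯ < n_{N'−1} ≤ N−1`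
such that the points `b·n_j` are pairwise within distance `ε` on the circle `ℝ/ℤ`
(with its quotient metric, i.e. distance of the difference to the nearest integer). -/
theorem stmt13 (b ε : ℝ) (hε : ε ∈ Set.Ioo (0 : ℝ) 1) (N' N : ℕ)
    (hN' : 0 < N') (hN : 0 < N) (h : N' * ⌈(1 : ℝ) / ε⌉₊ ≤ N) :
    ∃ n : ℕ → ℕ, n 0 = 0 ∧
      (∀ j j' : ℕ, j < j' → j' ≤ N' - 1 → n j < n j') ∧
      (∀ j : ℕ, j ≤ N' - 1 → n j ≤ N - 1) ∧
      ∀ j : ℕ, j ≤ N' - 1 → ∀ j' : ℕ, j' ≤ N' - 1 →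
        dist ((b * n j : ℝ) : UnitAddCircle) ((b * n j' : ℝ) : UnitAddCircle) ≤ ε := by
  obtain ⟨hε0, -⟩ := hε
  set M := ⌈(1 : ℝ) / ε⌉₊
  have hM : 0 < M := Nat.ceil_pos.2 (by positivity)
  have hM' : (0 : ℝ) < M := by exact_mod_cast hM
  have hMε : 1 / (M : ℝ) ≤ ε := (one_div_le hM' hε0).2 (Nat.le_ceil _)
  obtain ⟨c, -, hc⟩ := Finset.exists_le_card_fiber_of_mul_le_card_of_maps_to
    (s := Finset.range N) (t := Finset.range M) (f := fun k => ⌊M * Int.fract (b * k)⌋₊) (n := N')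
    (fun k _ => by
      rw [Finset.mem_range,
        Nat.floor_lt (mul_nonneg hM'.le (Int.fract_nonneg _))]
      exact mul_lt_of_lt_one_right hM' (Int.fract_lt_one _))
    (Finset.nonempty_range_iff.2 hM.ne') (by simpa [mul_comm] using h)
  obtain ⟨s, hs, hcard⟩ := Finset.exists_subset_card_eq hc
  let m := s.orderEmbOfFin hcard
  have hm (i : Fin N') : m i < N ∧ ⌊M * Int.fract (b * m i)⌋₊ = c := by
    simpa using hs (s.orderEmbOfFin_mem hcard i)
  have hm0 (i : Fin N') : m ⟨0, hN'⟩ ≤ m i := m.monotone (Nat.zero_le _)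
  refine ⟨fun j => if hj : j < N' then m ⟨j, hj⟩ - m ⟨0, hN'⟩ else 0, by simp [hN'], ?_, ?_, ?_⟩
  · intro j j' hjj' hj'
    have hj'N : j' < N' := by omega
    have hjN : j < N' := hjj'.trans hj'N
    simp only [hjN, hj'N, dite_true]
    exact Nat.sub_lt_sub_right (hm0 _) (m.strictMono hjj')
  · intro j hj
    have hjN : j < N' := by omega
    simp only [hjN, dite_true]
    have := (hm ⟨j, hjN⟩).1
    omega
  · intro j hj j' hj'
    have hjN : j < N' := by omega
    have hj'N : j' < N' := by omega
    simp only [hjN, hj'N, dite_true]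
    have hclose := abs_sub_sub_floor_sub_floor_le hM
      ((hm ⟨j, hjN⟩).2.trans (hm ⟨j', hj'N⟩).2.symm)
    refine UnitAddCircle.dist_coe_le_of_abs_sub_sub_intCast_le
      (⌊b * m ⟨j, hjN⟩⌋ - ⌊b * m ⟨j', hj'N⟩⌋) (le_trans ?_ hMε)
    rw [Nat.cast_sub (hm0 _), Nat.cast_sub (hm0 _), ← mul_sub, sub_sub_sub_cancel_right, mul_sub]
    exact hclose
end

section
/- Let (Ω, ℱ, ℙ) be a probability space with a filtration (ℱ_n)_{n∈ℕ}, and let (d_n)_{n∈ℕ} be real random variables such that each d_n is ℱ_n-measurable, 0 ≤ d_n ≤ 1 almost surely, d_{n+1} ≤ d_n almost surely for every n, and for some c ∈ (0,1] and every n the conditional expectation 𝔼[1_{{d_{n+1} ≤ d_n/2}} | ℱ_n] ≥ c almost surely. Then 𝔼[d_n] ≤ (1 − c/2)^n for every n ∈ ℕ. -/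
open MeasureTheory

/-- A lower bound on a conditional expectation passes to integrals against nonnegative bounded
measurable weights. -/
theorem mul_integral_le_integral_mul_of_le_condExp {Ω : Type*} {m m0 : MeasurableSpace Ω}
    {μ : Measure Ω} [IsFiniteMeasure μ] (hm : m ≤ m0) {f g : Ω → ℝ} {b c : ℝ}
    (hf : StronglyMeasurable[m] f) (hf0 : 0 ≤ᵐ[μ] f) (hfb : ∀ᵐ ω ∂μ, ‖f ω‖ ≤ b)
    (hg : Integrable g μ) (hc : ∀ᵐ ω ∂μ, c ≤ (μ[g|m]) ω) :
    c * ∫ ω, f ω ∂μ ≤ ∫ ω, f ω * g ω ∂μ := by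
  have hpull := condExp_stronglyMeasurable_mul_of_bound hm hf hg b hfb
  have hfint : Integrable f μ :=
    Integrable.of_bound (hf.mono hm).aestronglyMeasurable b hfb
  calc c * ∫ ω, f ω ∂μ = ∫ ω, c * f ω ∂μ := (integral_const_mul c f).symm
    _ ≤ ∫ ω, (μ[f * g|m]) ω ∂μ := by
      refine integral_mono_ae (hfint.const_mul c) integrable_condExp ?_
      filter_upwards [hpull, hf0, hc] with ω h h0 hcω
      rw [h, Pi.mul_apply, mul_comm]
      exact mul_le_mul_of_nonneg_left hcω h0
    _ = ∫ ω, f ω * g ω ∂μ := integral_condExp hm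

/-- if `(d_n)` is an adapted `[0,1]`-valued non-increasing sequence such that,
conditionally on `ℱ_n`, the probability that `d_{n+1} ≤ d_n/2` is a.s. at least `c`, then
`𝔼[d_n] ≤ (1 − c/2)^n`. -/
theorem stmt15 {Ω : Type*} {m0 : MeasurableSpace Ω} (ℙ : Measure Ω) [IsProbabilityMeasure ℙ]
    (ℱ : Filtration ℕ m0) (d : ℕ → Ω → ℝ)
    (hadapted : ∀ n, Measurable[ℱ n] (d n))
    (hbound : ∀ n, ∀ᵐ ω ∂ℙ, 0 ≤ d n ω ∧ d n ω ≤ 1)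
    (hmono : ∀ n, ∀ᵐ ω ∂ℙ, d (n + 1) ω ≤ d n ω)
    (c : ℝ) (hc0 : 0 < c) (hc1 : c ≤ 1)
    (hcond : ∀ n, ∀ᵐ ω ∂ℙ,
      c ≤ (ℙ[Set.indicator {ω' | d (n + 1) ω' ≤ d n ω' / 2} (fun _ => (1 : ℝ))|ℱ n]) ω) :
    ∀ n : ℕ, ∫ ω, d n ω ∂ℙ ≤ (1 - c / 2) ^ n := by
  have hmeas (n : ℕ) : Measurable (d n) := (hadapted n).mono (ℱ.le n) le_rfl
  have hnorm (n : ℕ) : ∀ᵐ ω ∂ℙ, ‖d n ω‖ ≤ 1 := by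
    filter_upwards [hbound n] with ω h
    rw [Real.norm_of_nonneg h.1]
    exact h.2
  have hint (n : ℕ) : Integrable (d n) ℙ :=
    Integrable.of_bound (hmeas n).aestronglyMeasurable 1 (hnorm n)
  intro n
  induction n with
  | zero =>
    calc ∫ ω, d 0 ω ∂ℙ ≤ ∫ _, (1 : ℝ) ∂ℙ :=
          integral_mono_ae (hint 0) (integrable_const 1) ((hbound 0).mono fun _ h => h.2)
      _ = (1 - c / 2) ^ 0 := by simp
  | succ n ih =>
    set A : Set Ω := {ω | d (n + 1) ω ≤ d n ω / 2}
    set g : Ω → ℝ := A.indicator fun _ => 1 with hg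
    have hA : MeasurableSet A := measurableSet_le (hmeas (n + 1)) ((hmeas n).div_const 2)
    have hgint : Integrable g ℙ := (integrable_const 1).indicator hA
    have hdg : Integrable (fun ω => d n ω * g ω) ℙ :=
      hgint.bdd_mul (hmeas n).aestronglyMeasurable (hnorm n)
    have hlow : c * ∫ ω, d n ω ∂ℙ ≤ ∫ ω, d n ω * g ω ∂ℙ :=
      mul_integral_le_integral_mul_of_le_condExp (ℱ.le n) (hadapted n).stronglyMeasurable
        ((hbound n).mono fun _ h => h.1) (hnorm n) hgint (hcond n)
    have hstep : ∫ ω, d (n + 1) ω ∂ℙ ≤ ∫ ω, (d n ω - d n ω * g ω / 2) ∂ℙ := by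
      refine integral_mono_ae (hint (n + 1)) ((hint n).sub (hdg.div_const 2)) ?_
      filter_upwards [hmono n] with ω h
      by_cases hω : ω ∈ A
      · have hhalf : d (n + 1) ω ≤ d n ω / 2 := hω
        simp only [hg, Set.indicator_of_mem hω]
        linarith
      · simpa only [hg, Set.indicator_of_notMem hω, mul_zero, zero_div, sub_zero] using h
    rw [integral_sub (hint n) (hdg.div_const 2), integral_div] at hstep
    calc ∫ ω, d (n + 1) ω ∂ℙ ≤ (1 - c / 2) * ∫ ω, d n ω ∂ℙ := by linarith
      _ ≤ (1 - c / 2) * (1 - c / 2) ^ n := mul_le_mul_of_nonneg_left ih (by linarith)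
      _ = (1 - c / 2) ^ (n + 1) := (pow_succ' _ _).symm
end
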